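/- For each digit i ∈ {0,1,2}, the set of points x ∈ [0,1] at which the ternary digit frequency ν_i(x) does not exist (i.e. the sequence N_i(x,k)/k has no limit as k → ∞) is dense in [0,1]. -/

import Mathlib

open Filter

/-- The `n`-th ternary digit of `x`: `⌊3^n x⌋ mod 3`. -/
noncomputable def ternDigit (x : ℝ) (n : ℕ) : ℤ := ⌊(3 : ℝ) ^ n * x⌋ % 3

/-- `N_i(x,k)`: the number of indices `1 ≤ n ≤ k` with `α_n(x) = i`. -/
noncomputable def digitCount (i : ℤ) (x : ℝ) (k : ℕ) : ℕ :=
  ((Finset.Icc 1 k).filter (fun n => ternDigit x n = i)).card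

/-- The frequency `ν_i(x)` exists and equals `v`. -/
def hasFreq (i : ℤ) (x : ℝ) (v : ℝ) : Prop :=
  Tendsto (fun k : ℕ => (digitCount i x k : ℝ) / k) atTop (nhds v)

/-- The asymptotic mean of digits `r(x)` exists and equals `r`. -/
def hasMean (x : ℝ) (r : ℝ) : Prop :=
  Tendsto (fun n : ℕ => (1 / (n : ℝ)) * ∑ k ∈ Finset.Icc 1 n, (ternDigit x k : ℝ))
    atTop (nhds r)

/-- Prepending ternary digits to `x` shifts the digits of `x`. -/
lemma ternDigit_add_div_pow (m : ℤ) (x : ℝ) (N n : ℕ) :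
    ternDigit ((m + x) / 3 ^ N) (N + (n + 1)) = ternDigit x (n + 1) := by
  have h : (3 : ℝ) ^ (N + (n + 1)) * ((m + x) / 3 ^ N)
      = 3 ^ (n + 1) * x + ((3 * (3 ^ n * m) : ℤ) : ℝ) := by
    push_cast
    field_simp
    ring
  rw [ternDigit, ternDigit, h, Int.floor_add_intCast, Int.add_mul_emod_self_left]

lemma digitCount_succ (i : ℤ) (x : ℝ) (k : ℕ) :
    digitCount i x (k + 1) = digitCount i x k + if ternDigit x (k + 1) = i then 1 else 0 := by
  rw [digitCount, digitCount, ← Finset.insert_Icc_right_eq_Icc_add_one (by lia),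
    Finset.filter_insert]
  split_ifs <;> simp

lemma digitCount_add_div_pow (i m : ℤ) (x : ℝ) (N k : ℕ) :
    digitCount i ((m + x) / 3 ^ N) (k + N) =
      digitCount i x k + digitCount i ((m + x) / 3 ^ N) N := by
  induction k with
  | zero => simp [digitCount]
  | succ k ih =>
    rw [Nat.add_right_comm, digitCount_succ, digitCount_succ, ih,
      show k + N + 1 = N + (k + 1) by ring, ternDigit_add_div_pow]
    ring

/-- The existence and value of a digit frequency do not depend on the first `N` digits. -/
lemma hasFreq_of_add_div_pow {i m : ℤ} {x v : ℝ} {N : ℕ}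
    (h : hasFreq i ((m + x) / 3 ^ N) v) : hasFreq i x v := by
  set c := digitCount i ((m + x) / 3 ^ N) N with hc
  have hinv : Tendsto (fun k : ℕ => ((k : ℝ))⁻¹) atTop (nhds 0) :=
    tendsto_inv_atTop_nhds_zero_nat
  have hquot : Tendsto (fun k : ℕ => 1 + (N : ℝ) * (k : ℝ)⁻¹) atTop (nhds 1) := by
    simpa using (hinv.const_mul (N : ℝ)).const_add 1
  have hlim := (((tendsto_add_atTop_iff_nat N).2 h).mul hquot).sub (hinv.const_mul (c : ℝ))
  rw [mul_one, mul_zero, sub_zero] at hlim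
  refine hlim.congr' ?_
  filter_upwards [eventually_gt_atTop 0] with k hk
  have hk' : (0 : ℝ) < k := by exact_mod_cast hk
  rw [digitCount_add_div_pow, ← hc]
  push_cast
  field_simp
  ring

lemma ofDigits_three_eq (d : ℕ → Fin 3) :
    Real.ofDigits d = (((d 0 : ℕ) : ℤ) + Real.ofDigits fun n => d (n + 1)) / 3 ^ 1 := by
  rw [Real.ofDigits_eq_sum_add_ofDigits d 1]
  simp [Real.ofDigitsTerm]
  ring

lemma ofDigits_three_lt_one {d : ℕ → Fin 3} {n : ℕ} (hn : d n ≠ 2) : Real.ofDigits d < 1 := by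
  induction n generalizing d with
  | zero =>
    have h0 : (d 0 : ℕ) ≤ 1 := by lia
    have h0' : ((d 0 : ℕ) : ℝ) ≤ 1 := by exact_mod_cast h0
    have := Real.ofDigits_le_one fun n => d (n + 1)
    rw [ofDigits_three_eq]
    push_cast
    linarith
  | succ n ih =>
    have h0 : (d 0 : ℕ) ≤ 2 := by lia
    have h0' : ((d 0 : ℕ) : ℝ) ≤ 2 := by exact_mod_cast h0
    have := ih (d := fun n => d (n + 1)) hn
    rw [ofDigits_three_eq]
    push_cast
    linarith

/-- A digit sequence that is not eventually `2` is the ternary representation of its value. -/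
lemma ternDigit_ofDigits {d : ℕ → Fin 3} (hd : ∃ᶠ n in atTop, d n ≠ 2) (n : ℕ) :
    ternDigit (Real.ofDigits d) (n + 1) = (d n : ℕ) := by
  have htail : ∃ᶠ n in atTop, d (n + 1) ≠ 2 := by
    rw [← map_add_atTop_eq_nat 1] at hd
    exact frequently_map.1 hd
  induction n generalizing d with
  | zero =>
    obtain ⟨m, hm⟩ := htail.exists
    have hfloor : ⌊Real.ofDigits fun n => d (n + 1)⌋ = 0 :=
      Int.floor_eq_zero_iff.2 ⟨Real.ofDigits_nonneg _, ofDigits_three_lt_one hm⟩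
    rw [ternDigit, ofDigits_three_eq, zero_add, mul_div_cancel₀ _ (by positivity),
      Int.floor_intCast_add, hfloor]
    have := (d 0).isLt
    lia
  | succ n ih =>
    rw [ofDigits_three_eq, Nat.add_comm (n + 1) 1, ternDigit_add_div_pow]
    refine ih htail ?_
    rw [← map_add_atTop_eq_nat 1] at htail
    exact frequently_map.1 htail

/-- The sequence which is constant on each block `[2 ^ m, 2 ^ (m + 1))`, with value `a` for even
`m` and `b` for odd `m`. -/
def dyadicBlocks (a b : Fin 3) (n : ℕ) : Fin 3 := if Even (Nat.log 2 n) then a else b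

lemma frequently_dyadicBlocks_ne_two (a : Fin 3) {b : Fin 3} (hb : b ≠ 2) :
    ∃ᶠ n in atTop, dyadicBlocks a b n ≠ 2 := by
  refine frequently_atTop.2 fun k => ⟨2 ^ (2 * k + 1), ?_, ?_⟩
  · have := Nat.lt_two_pow_self (n := 2 * k + 1)
    lia
  · rw [dyadicBlocks, Nat.log_pow one_lt_two, if_neg (by simp)]
    exact hb

lemma digitCount_dyadicBlocks {a b : Fin 3} (hb : b ≠ 2) (hab : b ≠ a) (m : ℕ) :
    digitCount (a : ℕ) (Real.ofDigits (dyadicBlocks a b)) (2 ^ (m + 1)) =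
      digitCount (a : ℕ) (Real.ofDigits (dyadicBlocks a b)) (2 ^ m) +
        if Even m then 2 ^ m else 0 := by
  have key : ∀ t ≤ 2 ^ m,
      digitCount (a : ℕ) (Real.ofDigits (dyadicBlocks a b)) (2 ^ m + t) =
        digitCount (a : ℕ) (Real.ofDigits (dyadicBlocks a b)) (2 ^ m) +
          if Even m then t else 0 := by
    intro t ht
    induction t with
    | zero => simp
    | succ t ih =>
      have hlog : Nat.log 2 (2 ^ m + t) = m :=
        Nat.log_eq_of_pow_le_of_lt_pow (by lia) (by rw [pow_succ]; lia)
      have hab' : (b : ℕ) ≠ a := Fin.val_ne_of_ne hab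
      rw [← add_assoc, digitCount_succ, ih (by lia),
        ternDigit_ofDigits (frequently_dyadicBlocks_ne_two a hb), dyadicBlocks, hlog]
      split_ifs <;> simp_all [add_assoc]
  rw [pow_succ, mul_two, key _ le_rfl]

lemma not_hasFreq_dyadicBlocks {a b : Fin 3} (hb : b ≠ 2) (hab : b ≠ a) (v : ℝ) :
    ¬ hasFreq (a : ℕ) (Real.ofDigits (dyadicBlocks a b)) v := by
  intro h
  set x := Real.ofDigits (dyadicBlocks a b) with hx
  set u : ℕ → ℝ := fun m => (digitCount (a : ℕ) x (2 ^ m) : ℝ) / ((2 ^ m : ℕ) : ℝ) with hu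
  have hlim : Tendsto u atTop (nhds v) :=
    h.comp (tendsto_pow_atTop_atTop_of_one_lt one_lt_two)
  have hrec : ∀ m, u (m + 1) = u m / 2 + if Even m then 1 / 2 else 0 := by
    intro m
    simp only [hu]
    rw [hx, digitCount_dyadicBlocks hb hab, pow_succ]
    push_cast
    split_ifs <;> field_simp
    simp
  have heven : Tendsto (fun k : ℕ => 2 * k) atTop atTop :=
    tendsto_id.const_mul_atTop' two_pos
  have hodd : Tendsto (fun k : ℕ => 2 * k + 1) atTop atTop :=
    tendsto_atTop_mono (fun k => Nat.le_succ _) heven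
  have h_even : v = v / 2 + 1 / 2 := by
    refine tendsto_nhds_unique (hlim.comp hodd)
      ((((hlim.comp heven).div_const 2).add_const (1 / 2)).congr fun k => ?_)
    simp [hrec]
  have h_odd : v = v / 2 := by
    refine tendsto_nhds_unique (hlim.comp (tendsto_atTop_mono (fun k => Nat.le_succ _) hodd))
      (((hlim.comp hodd).div_const 2).congr fun k => ?_)
    simp [hrec]
  linarith

lemma exists_forall_not_hasFreq {i : ℤ} (hi : i ∈ ({0, 1, 2} : Set ℤ)) :
    ∃ x ∈ Set.Icc (0 : ℝ) 1, ∀ v, ¬ hasFreq i x v := by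
  have h : ∃ a b : Fin 3, b ≠ 2 ∧ b ≠ a ∧ i = (a : ℕ) := by
    rcases hi with rfl | rfl | rfl
    · exact ⟨0, 1, by decide, by decide, rfl⟩
    · exact ⟨1, 0, by decide, by decide, rfl⟩
    · exact ⟨2, 0, by decide, by decide, rfl⟩
  obtain ⟨a, b, hb, hab, rfl⟩ := h
  exact ⟨_, ⟨Real.ofDigits_nonneg _, Real.ofDigits_le_one _⟩, not_hasFreq_dyadicBlocks hb hab⟩

/-- For each digit `i ∈ {0,1,2}`, the set of points of `[0,1]` where the
frequency `ν_i` does not exist is dense in `[0,1]`. -/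
theorem dense_no_freq (i : ℤ) (hi : i ∈ ({0, 1, 2} : Set ℤ)) :
    Set.Icc (0 : ℝ) 1 ⊆
      closure {x ∈ Set.Icc (0 : ℝ) 1 | ¬ ∃ v : ℝ, hasFreq i x v} := by
  obtain ⟨x₀, ⟨hx₀, hx₀'⟩, hfreq⟩ := exists_forall_not_hasFreq hi
  refine (closure_Ico (zero_ne_one' ℝ)).ge.trans ?_
  refine closure_minimal (fun x hx => ?_) isClosed_closure
  rw [Metric.mem_closure_iff]
  intro ε hε
  obtain ⟨N, hN⟩ := exists_pow_lt_of_lt_one hε (by norm_num : (1 / 3 : ℝ) < 1)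
  have hpos : (0 : ℝ) < 3 ^ N := by positivity
  set m : ℤ := ⌊3 ^ N * x⌋
  have hm : (m : ℝ) ≤ 3 ^ N * x := Int.floor_le _
  have hm' : 3 ^ N * x < m + 1 := Int.lt_floor_add_one _
  have hm₀ : (0 : ℝ) ≤ m := by
    exact Int.cast_nonneg (Int.floor_nonneg.2 (mul_nonneg hpos.le hx.1))
  have hm₁ : (m : ℝ) + 1 ≤ 3 ^ N := by
    have : m < 3 ^ N := Int.floor_lt.2 (by push_cast; nlinarith [hx.2])
    exact_mod_cast Int.add_one_le_of_lt this
  refine ⟨(m + x₀) / 3 ^ N, ⟨⟨by positivity, (div_le_one hpos).2 (by linarith)⟩, ?_⟩, ?_⟩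
  · rintro ⟨v, hv⟩
    exact hfreq v (hasFreq_of_add_div_pow hv)
  · have hdiff : x - (m + x₀) / 3 ^ N = (3 ^ N * x - (m + x₀)) / 3 ^ N := by field_simp
    have habs : |3 ^ N * x - (m + x₀)| ≤ 1 := abs_le.2 ⟨by linarith, by linarith⟩
    rw [Real.dist_eq, hdiff, abs_div, abs_of_pos hpos]
    calc |3 ^ N * x - (m + x₀)| / 3 ^ N ≤ 1 / 3 ^ N := by gcongr
      _ = (1 / 3) ^ N := by rw [one_div_pow]
      _ < ε := hN
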